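/- Let k satisfy 1 ≤ k ≤ n and suppose δ_k ∈ (0, 1/2] (i.e., δ_k ≠ 0). Then w_k(B_k) ≤ E_{k−1}/(4 δ_k (1−δ_k)). -/

import Mathlib

open Finset
open scoped Classical

/-- A hyperplane in `S_1 × ⋯ × S_n`.  Coordinates are 0-indexed in Lean:
coordinate `j : ℕ`, `j < n`, corresponds to the paper's coordinate `j + 1`,
so the paper's set `S_j` is `S (j - 1)` here.  A hyperplane is recorded by its
finite set `F` of fixed coordinates together with the fixed value at each
fixed coordinate (on the non-fixed coordinates it is all of `S j`). -/
structure Hyp (S : ℕ → Type) (n : ℕ) where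
  F : Finset ℕ
  hF : ∀ j ∈ F, j < n
  val : ∀ j ∈ F, S j

/-- The stage of a hyperplane: in the paper's 1-based labelling,
`A.stage = max F(A)`; in the 0-based labelling it is `(sup of A.F) + 1`. -/
def Hyp.stage {S : ℕ → Type} {n : ℕ} (A : Hyp S n) : ℕ := A.F.sup id + 1

/-- `Qp S k` is the paper's `Q_k = S_1 × ⋯ × S_k` (in 0-based indexing,
`S 0 × ⋯ × S (k-1)`).  `Qp S 0` is a one-element type. -/
abbrev Qp (S : ℕ → Type) (k : ℕ) := ∀ j : Fin k, S j

/-- `x ∈ Q_k` lies on (the projection to `Q_k` of) the hyperplane `A`;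
this is the correct notion of membership whenever `F(A) ⊆ {1, …, k}`. -/
def memH {S : ℕ → Type} {n : ℕ} (A : Hyp S n) {k : ℕ} (x : Qp S k) : Prop :=
  ∀ (j : Fin k) (h : (j : ℕ) ∈ A.F), x j = A.val j h

/-- Membership in `B_k = ⋃_{A ∈ 𝒜_k} A`, viewed as a subset of `Q_k`, where
`𝒜_k = {A ∈ 𝒜 : max F(A) = k}` (1-based `k`). -/
def memB {S : ℕ → Type} {n : ℕ} {ι : Type} (𝓐 : ι → Hyp S n) (k : ℕ) (x : Qp S k) : Prop :=
  ∃ i, (𝓐 i).stage = k ∧ memH (𝓐 i) x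

/-- `alpha 𝓐 k x` is the paper's `α_{k+1}(x)` for `x ∈ Q_k`: the proportion of
the fiber `F_x` covered by `B_{k+1}`. -/
noncomputable def alpha {S : ℕ → Type} [∀ j, Fintype (S j)] {n : ℕ} {ι : Type}
    (𝓐 : ι → Hyp S n) (k : ℕ) (x : Qp S k) : ℝ :=
  ((univ.filter fun y : S k => memB 𝓐 (k + 1) (Fin.snoc x y)).card : ℝ) /
    (Fintype.card (S k))

/-- The weights `w_k : Q_k → ℝ`, defined inductively:  `w_0 ≡ 1`, and `w_(k+1)`
is obtained from `w_k` by the distortion rule with parameter `δ_{k+1} = δ k`.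
(The paper's `δ_j` is `δ (j - 1)` here.) -/
noncomputable def w {S : ℕ → Type} [∀ j, Fintype (S j)] {n : ℕ} {ι : Type}
    (𝓐 : ι → Hyp S n) (δ : ℕ → ℝ) : (k : ℕ) → Qp S k → ℝ
  | 0, _ => 1
  | (k + 1), x =>
      let x' : Qp S k := fun j => x j.castSucc
      let a : ℝ := alpha 𝓐 k x'
      if memB 𝓐 (k + 1) x then
        if a ≤ δ k then 0
        else ((a - δ k) / (a * (1 - δ k))) * (w 𝓐 δ k x' / (Fintype.card (S k)))
      else
        if a ≤ δ k then (1 / (1 - a)) * (w 𝓐 δ k x' / (Fintype.card (S k)))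
        else (1 / (1 - δ k)) * (w 𝓐 δ k x' / (Fintype.card (S k)))

/-- `w_k(B_k)` (1-based `k`). -/
noncomputable def wB {S : ℕ → Type} [∀ j, Fintype (S j)] {n : ℕ} {ι : Type}
    (𝓐 : ι → Hyp S n) (δ : ℕ → ℝ) (k : ℕ) : ℝ :=
  ∑ x ∈ univ.filter (memB 𝓐 k), w 𝓐 δ k x

/-- `w_k(A)`: the weight of the projection to `Q_k` of a hyperplane `A`
(meaningful when `F(A) ⊆ {1, …, k}`). -/
noncomputable def wH {S : ℕ → Type} [∀ j, Fintype (S j)] {n : ℕ} {ι : Type}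
    (𝓐 : ι → Hyp S n) (δ : ℕ → ℝ) (k : ℕ) (A : Hyp S n) : ℝ :=
  ∑ x ∈ univ.filter (fun x : Qp S k => memH A x), w 𝓐 δ k x

/-- `ν(J) = ∏_{j ∈ J} 1 / ((1 - δ_j)|S_j|)` (0-based `J`). -/
noncomputable def nu (S : ℕ → Type) [∀ j, Fintype (S j)] (δ : ℕ → ℝ) (J : Finset ℕ) : ℝ :=
  ∏ j ∈ J, 1 / ((1 - δ j) * (Fintype.card (S j)))

/-- `‖J‖ = ∏_{j ∈ J} |S_j|` (0-based `J`). -/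
noncomputable def normJ (S : ℕ → Type) [∀ j, Fintype (S j)] (J : Finset ℕ) : ℝ :=
  ∏ j ∈ J, (Fintype.card (S j) : ℝ)

/-- `Ew 𝓐 δ k` is the paper's `E_k = E_{(k+1)-1} = ∑_{x ∈ Q_k} α_{k+1}(x)² w_k(x)`. -/
noncomputable def Ew {S : ℕ → Type} [∀ j, Fintype (S j)] {n : ℕ} {ι : Type}
    (𝓐 : ι → Hyp S n) (δ : ℕ → ℝ) (k : ℕ) : ℝ :=
  ∑ x : Qp S k, (alpha 𝓐 k x) ^ 2 * w 𝓐 δ k x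

theorem alpha_nonneg {S : ℕ → Type} [∀ j, Fintype (S j)] {n : ℕ} {ι : Type}
    (𝓐 : ι → Hyp S n) (k : ℕ) (x : Qp S k) : 0 ≤ alpha 𝓐 k x := by
  unfold alpha
  positivity

theorem w_nonneg {S : ℕ → Type} [∀ j, Fintype (S j)] {n : ℕ} {ι : Type}
    (𝓐 : ι → Hyp S n) {δ : ℕ → ℝ} {k : ℕ} (hδ : ∀ j < k, δ j < 1) (x : Qp S k) :
    0 ≤ w 𝓐 δ k x := by
  induction k with
  | zero => simp [w]
  | succ k ih =>
    have hδk := hδ k k.lt_succ_self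
    have hw : 0 ≤ w 𝓐 δ k (fun j => x j.castSucc) / (Fintype.card (S k) : ℝ) :=
      div_nonneg (ih (fun j hj => hδ j (hj.trans k.lt_succ_self)) _) (Nat.cast_nonneg _)
    have ha := alpha_nonneg 𝓐 k (fun j => x j.castSucc)
    rw [w]
    split_ifs with _ h h
    · exact le_rfl
    · exact mul_nonneg (div_nonneg (by linarith) (mul_nonneg ha (by linarith))) hw
    · exact mul_nonneg (one_div_nonneg.2 (by linarith)) hw
    · exact mul_nonneg (one_div_nonneg.2 (by linarith)) hw

/-- The part of `B_(k+1)` in the fiber over `x` carries weight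
`max 0 ((α - δ) / (1 - δ)) * w_k(x)`. -/
theorem sum_fiber_w {S : ℕ → Type} [∀ j, Fintype (S j)] {n : ℕ} {ι : Type}
    (𝓐 : ι → Hyp S n) {δ : ℕ → ℝ} {k : ℕ} (hδ : 0 ≤ δ k) (x : Qp S k) :
    (∑ y : S k, if memB 𝓐 (k + 1) (Fin.snoc x y) then w 𝓐 δ (k + 1) (Fin.snoc x y) else 0) =
      if alpha 𝓐 k x ≤ δ k then 0 else (alpha 𝓐 k x - δ k) / (1 - δ k) * w 𝓐 δ k x := by
  have hinit (y : S k) :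
      (fun j : Fin k => (Fin.snoc x y : Qp S (k + 1)) j.castSucc) = x := by
    funext j
    exact Fin.snoc_castSucc (α := fun j : Fin (k + 1) => S j) y x j
  have hterm (y : S k) :
      (if memB 𝓐 (k + 1) (Fin.snoc x y) then w 𝓐 δ (k + 1) (Fin.snoc x y) else 0) =
      if memB 𝓐 (k + 1) (Fin.snoc x y) then
        (if alpha 𝓐 k x ≤ δ k then 0 else ((alpha 𝓐 k x - δ k) / (alpha 𝓐 k x * (1 - δ k))) *
          (w 𝓐 δ k x / (Fintype.card (S k)))) else 0 := by
    split_ifs with h h'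
    · rw [w]
      rw [hinit, if_pos h, if_pos h']
    · rw [w]
      rw [hinit, if_pos h, if_neg h']
    · rfl
  rw [sum_congr rfl fun y _ => hterm y, ← sum_filter, sum_const, nsmul_eq_mul]
  split_ifs with h
  · exact mul_zero _
  · have ha : alpha 𝓐 k x ≠ 0 := (hδ.trans_lt (not_le.1 h)).ne'
    have hc : (Fintype.card (S k) : ℝ) ≠ 0 := by
      intro hc
      exact ha (by rw [alpha, hc, div_zero])
    have hcount : ((univ.filter fun y : S k => memB 𝓐 (k + 1) (Fin.snoc x y)).card : ℝ) =
        alpha 𝓐 k x * Fintype.card (S k) := by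
      rw [alpha, div_mul_cancel₀ _ hc]
    rw [hcount]
    field_simp

theorem wB_succ {S : ℕ → Type} [∀ j, Fintype (S j)] {n : ℕ} {ι : Type}
    (𝓐 : ι → Hyp S n) {δ : ℕ → ℝ} {k : ℕ} (hδ : 0 ≤ δ k) :
    wB 𝓐 δ (k + 1) = ∑ x : Qp S k,
      if alpha 𝓐 k x ≤ δ k then 0 else (alpha 𝓐 k x - δ k) / (1 - δ k) * w 𝓐 δ k x := by
  simp_rw [← sum_fiber_w 𝓐 hδ]
  rw [wB, sum_filter, ← Equiv.sum_comp (Fin.snocEquiv fun j : Fin (k + 1) => S j),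
    Fintype.sum_prod_type_right]
  rfl

/-- **Lemma 4.**  For `1 ≤ k ≤ n` (the paper's `k` is `k + 1` here, `k < n`)
with `δ_k ∈ (0, 1/2]`, one has `w_k(B_k) ≤ E_{k-1} / (4 δ_k (1 - δ_k))`. -/
theorem wB_le_E_div
    (S : ℕ → Type) [∀ j, Fintype (S j)] (n : ℕ) (hn : 0 < n)
    (hcard : ∀ j, j < n → 2 ≤ Fintype.card (S j))
    (δ : ℕ → ℝ) (hδ : ∀ j, j < n → δ j ∈ Set.Icc (0 : ℝ) (1 / 2))
    (ι : Type) [Fintype ι] (𝓐 : ι → Hyp S n)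
    (hFne : ∀ i, (𝓐 i).F.Nonempty)
    (k : ℕ) (hk : k < n) (hδk : 0 < δ k) :
    wB 𝓐 δ (k + 1) ≤ Ew 𝓐 δ k / (4 * δ k * (1 - δ k)) := by
  have hδ1 : δ k < 1 := (hδ k hk).2.trans_lt (by norm_num)
  rw [wB_succ 𝓐 hδk.le, Ew, sum_div]
  refine sum_le_sum fun x _ => ?_
  have hw : 0 ≤ w 𝓐 δ k x :=
    w_nonneg 𝓐 (fun j hj => (hδ j (hj.trans hk)).2.trans_lt (by norm_num)) x
  have h1 : 0 < 1 - δ k := sub_pos.2 hδ1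
  have hsq : (alpha 𝓐 k x - δ k) / (1 - δ k) ≤ alpha 𝓐 k x ^ 2 / (4 * δ k * (1 - δ k)) := by
    rw [← div_div]
    gcongr
    rw [le_div_iff₀ (by positivity)]
    linarith [sq_nonneg (alpha 𝓐 k x - 2 * δ k)]
  split_ifs
  · positivity
  · rw [mul_div_right_comm]
    exact mul_le_mul_of_nonneg_right hsq hw
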